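/- Let q be an odd prime power and let φ, ψ ∈ F_q(x) be two separable permutation rational functions of degree 3. Then φ is equivalent to ψ. -/

import Mathlib

open Polynomial

noncomputable section

open scoped Classical in
/-- The self-map of `ℙ¹(F) = F ∪ {∞}` (encoded as `Option F`, with `none` = `∞`)
induced by the rational function `f/g`, where `f, g` are coprime polynomials. -/
def ratEval {F : Type} [Field F] (f g : F[X]) : Option F → Option F := fun x =>
  match x with
  | some a => if g.eval a ≠ 0 then some (f.eval a / g.eval a) else none
  | none =>
      if g.natDegree < f.natDegree then none
      else if f.natDegree < g.natDegree then some 0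
      else some (f.leadingCoeff / g.leadingCoeff)

/-- The polynomial `f(x) - t·g(x)` over the rational function field `F(t)`. -/
def fiberPoly {F : Type} [Field F] (f g : F[X]) : Polynomial (RatFunc F) :=
  f.map (algebraMap F (RatFunc F)) - Polynomial.C RatFunc.X * g.map (algebraMap F (RatFunc F))

/-- Composition of rational functions: `(f/g) ∘ ψ = f(ψ)/g(ψ)`. -/
def rfComp {F : Type} [Field F] (φ ψ : RatFunc F) : RatFunc F :=
  Polynomial.aeval ψ φ.num / Polynomial.aeval ψ φ.denom

/-- A Möbius transformation `(ax + b)/(cx + d)` with `ad - bc ≠ 0`. -/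
def IsMobius {F : Type} [Field F] (m : RatFunc F) : Prop :=
  ∃ a b c d : F, a * d - b * c ≠ 0 ∧
    m = (RatFunc.C a * RatFunc.X + RatFunc.C b) / (RatFunc.C c * RatFunc.X + RatFunc.C d)

/-- Equivalence of rational functions: `φ ∼ ψ` iff `m₁ ∘ φ ∘ m₂ = ψ` for some
Möbius transformations `m₁, m₂`. -/
def RFEquiv {F : Type} [Field F] (φ ψ : RatFunc F) : Prop :=
  ∃ m₁ m₂ : RatFunc F, IsMobius m₁ ∧ IsMobius m₂ ∧ rfComp m₁ (rfComp φ m₂) = ψ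

/-- If every value of a polynomial `D` of degree at most four over `𝔽_q`, with `q ≥ 7` odd, is a
nonzero nonsquare, then `D` satisfies a pair of differential equations with a quadratic `k`. -/
lemma exists_quadratic_of_forall_pow_eq_neg_one {F : Type} [Field F] [Fintype F] {n : ℕ}
    (hn : Fintype.card F = 2 * n + 1) (hq : 7 ≤ Fintype.card F) (D : F[X])
    (hD : D.natDegree ≤ 4) (h : ∀ x, D.eval x ^ n = -1) :
    ∃ k : F[X], k.natDegree ≤ 2 ∧ derivative D * k = 2 * D * derivative k ∧
      derivative D ^ 2 - 2 * D * derivative (derivative D) - 4 * D * k = 0 := by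
  set q := Fintype.card F with hqdef
  have hq1 : 1 < q := by omega
  set N : F[X] := X ^ q - X with hN
  have hNdeg : N.natDegree = q := FiniteField.X_pow_card_sub_X_natDegree_eq F hq1
  have hN0 : N ≠ 0 := FiniteField.X_pow_card_sub_X_ne_zero F hq1
  have hNmonic : N.Monic := monic_X_pow_sub (by rw [degree_X]; exact_mod_cast hq1)
  have hcast : (q : F[X]) = 0 := by
    rw [← C_eq_natCast, hqdef, FiniteField.cast_card_eq_zero, C_0]
  have hNder : derivative N = -1 := by
    simp [hN, derivative_X_pow, hqdef]
  have hdvd : N ∣ D ^ n + 1 := by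
    have hroots : N.roots = Finset.univ.val := FiniteField.roots_X_pow_card_sub_X F
    have hprod : (N.roots.map fun a => X - C a).prod = N := by
      apply prod_multiset_X_sub_C_of_monic_of_roots_card_eq hNmonic
      rw [hroots, hNdeg]; rfl
    rw [← hprod, hroots]
    refine Finset.prod_dvd_of_coprime ?_ ?_
    · intro a _ b _ hab
      exact pairwise_coprime_X_sub_C Function.injective_id hab
    · intro a _
      rw [dvd_iff_isRoot]
      simp [h a]
  obtain ⟨g, hg⟩ := hdvd
  have hode : 2 * D * derivative (D ^ n) + derivative D * D ^ n = 0 := by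
    have h2 : (2 * (n : F[X]) + 1) = 0 := by rw [← hcast, hn]; push_cast; ring
    rcases Nat.eq_zero_or_pos n with h0 | hpos
    · omega
    · obtain ⟨m, rfl⟩ : ∃ m, n = m + 1 := ⟨n - 1, by omega⟩
      rw [derivative_pow]
      simp only [Nat.add_sub_cancel, C_eq_natCast]
      linear_combination (derivative D * D ^ (m + 1)) * h2
  have hP : D ^ n = N * g - 1 := by rw [← hg]; ring
  have hP' : derivative (D ^ n) = - g + N * derivative g := by
    rw [hP]; simp [hNder]
  rw [hP', hP] at hode
  set k := 2 * D * derivative g + derivative D * g with hk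
  have hA : N * k = derivative D + 2 * D * g := by
    rw [hk]; linear_combination hode
  have hB : N * derivative k = derivative (derivative D) + derivative D * g + 2 * k := by
    have := congrArg derivative hA
    have h2 : derivative (2 : F[X]) = 0 := derivative_ofNat 2
    simp only [derivative_mul, derivative_add, hNder, h2] at this
    linear_combination this - hk
  have htwo (p : F[X]) : (2 * p).natDegree ≤ p.natDegree := by
    rw [← map_ofNat C 2]; exact natDegree_C_mul_le _ p
  have hfour (p : F[X]) : (4 * p).natDegree ≤ p.natDegree := by
    rw [← map_ofNat C 4]; exact natDegree_C_mul_le _ p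
  have hgdeg : q + g.natDegree ≤ 4 * n := by
    have h1 : (N * g).natDegree ≤ 4 * n := by
      rw [← hg]
      refine natDegree_add_le_of_degree_le ?_ (by simp)
      exact natDegree_pow_le_of_le n hD |>.trans (by omega)
    rcases eq_or_ne g 0 with rfl | hg0
    · simp only [natDegree_zero]; omega
    · rwa [hNmonic.natDegree_mul' hg0, hNdeg] at h1
  have hkdeg : k.natDegree ≤ 2 := by
    rcases eq_or_ne k 0 with h0 | h0
    · simp [h0]
    have h1 : (N * k).natDegree ≤ q + 2 := by
      rw [hA]
      refine natDegree_add_le_of_degree_le ((natDegree_derivative_le D).trans (by omega)) ?_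
      rw [mul_assoc]
      refine (htwo _).trans ?_
      exact natDegree_mul_le.trans (by omega)
    rw [hNmonic.natDegree_mul' h0, hNdeg] at h1
    omega
  have key : N * (derivative D * k - 2 * D * derivative k) =
      derivative D ^ 2 - 2 * D * derivative (derivative D) - 4 * D * k := by
    linear_combination derivative D * hA - 2 * D * hB
  have hD1 := natDegree_derivative_le D
  have hD2 := natDegree_derivative_le (derivative D)
  have hR : (derivative D ^ 2 - 2 * D * derivative (derivative D) - 4 * D * k).natDegree ≤ 6 := by
    refine (natDegree_sub_le_of_le (m := 6) (n := 6)
      (natDegree_sub_le_of_le (m := 6) (n := 6) ?_ ?_) ?_).trans (by simp)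
    · exact natDegree_pow_le_of_le 2 (hD1.trans (by omega : _ ≤ 3))
    · rw [mul_assoc]
      refine (htwo _).trans (natDegree_mul_le.trans (by omega))
    · rw [mul_assoc]
      refine (hfour _).trans (natDegree_mul_le.trans (by omega))
  have hE : derivative D * k - 2 * D * derivative k = 0 := by
    by_contra h0
    rw [← key, hNmonic.natDegree_mul' h0, hNdeg] at hR
    omega
  refine ⟨k, hkdeg, sub_eq_zero.mp hE, ?_⟩
  rw [← key, hE, mul_zero]

lemma ringChar_ne_two_of_odd_card {F : Type} [Field F] [Fintype F]
    (hodd : Odd (Fintype.card F)) : ringChar F ≠ 2 := by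
  intro h
  have := FiniteField.even_card_iff_char_two.mp h
  rw [Nat.odd_iff] at hodd
  omega

lemma two_ne_zero_of_odd_card {F : Type} [Field F] [Fintype F]
    (hodd : Odd (Fintype.card F)) : (2 : F) ≠ 0 :=
  Ring.two_ne_zero (ringChar_ne_two_of_odd_card hodd)

lemma isSquare_mul_of_not_isSquare {F : Type} [Field F] [Fintype F] {a b : F}
    (ha : ¬IsSquare a) (hb : ¬IsSquare b) : IsSquare (a * b) := by
  classical
  by_contra h
  rw [← quadraticChar_neg_one_iff_not_isSquare] at ha hb h
  rw [map_mul, ha, hb] at h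
  norm_num at h

/-- The discriminant of `((x² - d)(y² - d) - axy - ad - b(x + y))` as a quadratic in `y`; its
values control the fibres of the rational function `x + (ax + b)/(x² - d)`. -/
def fiberDisc {F : Type} [Field F] (d a b x : F) : F :=
  (a * x + b) ^ 2 + 4 * (x ^ 2 - d) * (d * x ^ 2 + b * x + a * d - d ^ 2)

lemma exists_isSquare_fiberDisc_zmod_three : ∀ d a b : ZMod 3, (∀ z, z * z ≠ d) →
    (a ≠ 0 ∨ b ≠ 0) → ∃ x z : ZMod 3, (a * x + b) ^ 2 +
      4 * (x ^ 2 - d) * (d * x ^ 2 + b * x + a * d - d ^ 2) = z * z := by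
  decide

lemma exists_isSquare_fiberDisc_zmod_five : ∀ d a b : ZMod 5, (∀ z, z * z ≠ d) →
    (a ≠ 0 ∨ b ≠ 0) → ∃ x z : ZMod 5, (a * x + b) ^ 2 +
      4 * (x ^ 2 - d) * (d * x ^ 2 + b * x + a * d - d ^ 2) = z * z := by
  decide +kernel

lemma exists_isSquare_fiberDisc_of_ringEquiv {R F : Type} [Field R] [Field F] (e : R ≃+* F)
    (h : ∀ d a b : R, (∀ z, z * z ≠ d) → (a ≠ 0 ∨ b ≠ 0) → ∃ x z : R, (a * x + b) ^ 2 +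
      4 * (x ^ 2 - d) * (d * x ^ 2 + b * x + a * d - d ^ 2) = z * z)
    {d a b : F} (hd : ¬IsSquare d) (hab : a ≠ 0 ∨ b ≠ 0) :
    ∃ x, IsSquare (fiberDisc d a b x) := by
  obtain ⟨x, z, hxz⟩ := h (e.symm d) (e.symm a) (e.symm b)
    (fun z hz => hd ⟨e z, by rw [← map_mul, hz, e.apply_symm_apply]⟩) (by simpa using hab)
  refine ⟨e x, e z, ?_⟩
  have := congrArg e hxz
  simpa [fiberDisc, map_ofNat e 4] using this

/-- If the fibre discriminant takes only nonzero nonsquare values over `𝔽_q` with `q ≥ 7`, then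
`x + (ax + b)/(x² - d)` has two conjugate triple points. -/
lemma eq_of_not_isSquare_fiberDisc_of_seven_le {F : Type} [Field F] [Fintype F]
    (hodd : Odd (Fintype.card F)) (hq : 7 ≤ Fintype.card F) {d a b : F} (hd : ¬IsSquare d)
    (hab : a ≠ 0 ∨ b ≠ 0) (h : ∀ x, ¬IsSquare (fiberDisc d a b x)) :
    b = 0 ∧ a = -8 * d := by
  have h2 : (2 : F) ≠ 0 := two_ne_zero_of_odd_card hodd
  have hd0 : d ≠ 0 := fun h => hd (h ▸ IsSquare.zero)
  set D : F[X] := (C a * X + C b) ^ 2 +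
    4 * (X ^ 2 - C d) * (C d * X ^ 2 + C b * X + C (a * d - d ^ 2)) with hDdef
  have hDeq : D = C (4 * d) * X ^ 4 + C (4 * b) * X ^ 3 + C (a ^ 2 + 4 * a * d - 8 * d ^ 2) * X ^ 2
      + C (2 * a * b - 4 * b * d) * X + C (b ^ 2 - 4 * a * d ^ 2 + 4 * d ^ 3) := by
    simp only [hDdef, map_add, map_sub, map_mul, map_pow, map_ofNat]
    ring
  have heval (x : F) : D.eval x = fiberDisc d a b x := by
    simp only [hDeq, fiberDisc, eval_add, eval_mul, eval_C, eval_pow, eval_X]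
    ring
  obtain ⟨n, hn⟩ := hodd
  have hpow (x : F) : D.eval x ^ n = -1 := by
    rw [heval]
    have hchar := ringChar_ne_two_of_odd_card (F := F) ⟨n, hn⟩
    have hx0 : fiberDisc d a b x ≠ 0 := fun h0 => h x (h0 ▸ IsSquare.zero)
    have hhalf : Fintype.card F / 2 = n := by omega
    have h1 := FiniteField.pow_dichotomy hchar hx0
    have h3 := FiniteField.isSquare_iff hchar hx0
    rw [hhalf] at h1 h3
    exact h1.resolve_left fun h4 => h x (h3.mpr h4)
  have hDdeg : D.natDegree ≤ 4 := by rw [hDeq]; compute_degree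
  obtain ⟨k, hk, hE, hR⟩ := exists_quadratic_of_forall_pow_eq_neg_one hn hq D hDdeg hpow
  obtain ⟨k₀, k₁, k₂, rfl⟩ : ∃ k₀ k₁ k₂, k = C k₂ * X ^ 2 + C k₁ * X + C k₀ := by
    refine ⟨k.coeff 0, k.coeff 1, k.coeff 2, ?_⟩
    conv_lhs => rw [k.as_sum_range_C_mul_X_pow' (n := 3) (by omega)]
    simp [Finset.sum_range_succ]; ring
  obtain ⟨c₂, hc₂⟩ : ∃ c, c = a ^ 2 + 4 * a * d - 8 * d ^ 2 := ⟨_, rfl⟩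
  obtain ⟨c₁, hc₁⟩ : ∃ c, c = 2 * a * b - 4 * b * d := ⟨_, rfl⟩
  obtain ⟨c₀, hc₀⟩ : ∃ c, c = b ^ 2 - 4 * a * d ^ 2 + 4 * d ^ 3 := ⟨_, rfl⟩
  rw [hDeq, ← hc₂, ← hc₁, ← hc₀] at hE hR
  have hE' : C (2 * (4 * d) * k₁ - (4 * b) * k₂) * X ^ 4
      + C (4 * (4 * d) * k₀ + 4 * b * k₁ - 2 * c₂ * k₂) * X ^ 3
      + C (3 * (4 * b) * k₀ - 3 * c₁ * k₂) * X ^ 2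
      + C (2 * c₂ * k₀ - c₁ * k₁ - 4 * c₀ * k₂) * X + C (c₁ * k₀ - 2 * c₀ * k₁) = 0 := by
    rw [← sub_eq_zero] at hE
    rw [← hE]
    simp only [derivative_mul, derivative_C, derivative_X_pow, derivative_X,
      map_add, map_sub, map_mul, map_ofNat]
    norm_num
    simp only [map_ofNat]
    ring
  have hR' : C (-8 * (4 * d) ^ 2 - 4 * (4 * d) * k₂) * X ^ 6
      + C (-12 * (4 * d) * (4 * b) - 4 * (4 * d * k₁ + 4 * b * k₂)) * X ^ 5
      + C (-12 * (4 * d) * c₂ - 3 * (4 * b) ^ 2 - 4 * (4 * d * k₀ + 4 * b * k₁ + c₂ * k₂)) * X ^ 4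
      + C (-16 * (4 * d) * c₁ - 4 * (4 * b) * c₂
        - 4 * (4 * b * k₀ + c₂ * k₁ + c₁ * k₂)) * X ^ 3
      + C (-24 * (4 * d) * c₀ - 6 * (4 * b) * c₁ - 4 * (c₂ * k₀ + c₁ * k₁ + c₀ * k₂)) * X ^ 2
      + C (-12 * (4 * b) * c₀ - 4 * (c₁ * k₀ + c₀ * k₁)) * X
      + C (c₁ ^ 2 - 4 * c₂ * c₀ - 4 * c₀ * k₀) = 0 := by
    rw [← hR]
    simp only [derivative_mul, derivative_C, derivative_X_pow, derivative_X,
      map_add, map_sub, map_mul, map_pow, map_ofNat, map_neg]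
    norm_num
    simp only [map_ofNat]
    ring
  have e4 := congrArg (coeff · 4) hE'
  have e3 := congrArg (coeff · 3) hE'
  have e1 := congrArg (coeff · 1) hE'
  have r6 := congrArg (coeff · 6) hR'
  have r3 := congrArg (coeff · 3) hR'
  simp [coeff_C, -map_add, -map_sub, -map_mul, -map_neg] at e4 e3 e1 r6 r3
  have hk₂ : k₂ = -8 * d := by
    have : (2 ^ 4 * d) * (k₂ + 8 * d) = 0 := by linear_combination -r6
    have h0 : (2 ^ 4 * d) ≠ 0 := by positivity
    linear_combination (mul_eq_zero.mp this).resolve_left h0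
  have hk₁ : k₁ = -4 * b := by
    have : (2 ^ 3 * d) * (k₁ + 4 * b) = 0 := by linear_combination e4 + 4 * b * hk₂
    have h0 : (2 ^ 3 * d) ≠ 0 := by positivity
    linear_combination (mul_eq_zero.mp this).resolve_left h0
  subst hk₁ hk₂
  have hk₀ : d * k₀ = b ^ 2 - d * c₂ := by
    have : (2 ^ 4) * (d * k₀ - (b ^ 2 - d * c₂)) = 0 := by linear_combination e3
    have h0 : (2 ^ 4 : F) ≠ 0 := by positivity
    linear_combination (mul_eq_zero.mp this).resolve_left h0
  have hb : b = 0 := by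
    by_contra hb
    have h3 : 2 * d * c₁ + b * k₀ = 0 := by
      have : (2 ^ 4) * (2 * d * c₁ + b * k₀) = 0 := by linear_combination -r3
      have h0 : (2 ^ 4 : F) ≠ 0 := by positivity
      exact (mul_eq_zero.mp this).resolve_left h0
    have h4 : b * (b ^ 2 - a ^ 2 * d) = 0 := by
      linear_combination d * h3 - b * hk₀ - 2 * d ^ 2 * hc₁ + b * d * hc₂
    have h5 := (mul_eq_zero.mp h4).resolve_left hb
    have ha : a ≠ 0 := by
      rintro rfl
      exact hb (by simpa using h5)
    refine hd ⟨b / a, ?_⟩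
    field_simp
    linear_combination -h5
  subst hb
  have ha : a ≠ 0 := by simpa using hab
  refine ⟨rfl, ?_⟩
  have h6 : 2 * d * a ^ 3 * (a + 8 * d) = 0 := by
    subst hc₂ hc₁ hc₀
    linear_combination -d * e1 + 2 * (a ^ 2 + 4 * a * d - 8 * d ^ 2) * hk₀
  have h0 : 2 * d * a ^ 3 ≠ 0 := by positivity
  linear_combination (mul_eq_zero.mp h6).resolve_left h0


/-- If the fibre discriminant takes only nonzero nonsquare values over `𝔽_q` with `q` odd, then
`x + (ax + b)/(x² - d)` has two conjugate triple points. -/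
lemma eq_of_not_isSquare_fiberDisc {F : Type} [Field F] [Fintype F]
    (hodd : Odd (Fintype.card F)) {d a b : F} (hd : ¬IsSquare d)
    (hab : a ≠ 0 ∨ b ≠ 0) (h : ∀ x, ¬IsSquare (fiberDisc d a b x)) :
    b = 0 ∧ a = -8 * d := by
  have hone : 1 < Fintype.card F := Fintype.one_lt_card
  rcases le_or_gt 7 (Fintype.card F) with h7 | h7
  · exact eq_of_not_isSquare_fiberDisc_of_seven_le hodd h7 hd hab h
  · obtain ⟨m, hm⟩ := hodd
    obtain h3 | h5 : Fintype.card F = 3 ∨ Fintype.card F = 5 := by omega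
    · have : Fact (Nat.Prime 3) := ⟨by norm_num⟩
      obtain ⟨x, hx⟩ := exists_isSquare_fiberDisc_of_ringEquiv
        (ZMod.ringEquivOfPrime F (by norm_num) h3) exists_isSquare_fiberDisc_zmod_three hd hab
      exact absurd hx (h x)
    · have : Fact (Nat.Prime 5) := ⟨by norm_num⟩
      obtain ⟨x, hx⟩ := exists_isSquare_fiberDisc_of_ringEquiv
        (ZMod.ringEquivOfPrime F (by norm_num) h5) exists_isSquare_fiberDisc_zmod_five hd hab
      exact absurd hx (h x)

/-- An injectivity criterion for `x + (ax + b)/(x² - d)` on `𝔽_q`: either it has a rational triple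
point `r`, or it has two conjugate triple points. -/
lemma exists_triple_point_or {F : Type} [Field F] [Fintype F]
    (hodd : Odd (Fintype.card F)) {d a b : F} (hd : ¬IsSquare d) (hab : a ≠ 0 ∨ b ≠ 0)
    (h : ∀ x y, x ≠ y →
      (x ^ 2 - d) * (y ^ 2 - d) - a * x * y - a * d - b * (x + y) ≠ 0) :
    (∃ r, a = 3 * r ^ 2 + d ∧ b = -r ^ 3 - 3 * r * d) ∨
      (b = 0 ∧ a = -8 * d ∧ ¬IsSquare (-3 * d)) := by
  have h2 : (2 : F) ≠ 0 := two_ne_zero_of_odd_card hodd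
  have hsub (x : F) : x ^ 2 - d ≠ 0 := fun h0 => hd ⟨x, by linear_combination -h0⟩
  have hd0 : d ≠ 0 := fun h => hd (h ▸ IsSquare.zero)
  have hroot (x z : F) (hz : fiberDisc d a b x = z * z) :
      a * x + b + z = 2 * (x ^ 2 - d) * x := by
    by_contra hne
    have hx := hsub x
    refine h x ((a * x + b + z) / (2 * (x ^ 2 - d))) ?_ ?_
    · intro h0
      rw [eq_div_iff (by positivity)] at h0
      exact hne (by linear_combination -h0)
    · rw [fiberDisc] at hz
      field_simp
      linear_combination -hz
  by_cases hsq : ∃ r, IsSquare (fiberDisc d a b r)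
  · left
    obtain ⟨r, z, hz⟩ := hsq
    have e1 := hroot r z hz
    have e2 := hroot r (-z) (by linear_combination hz)
    have hz0 : z = 0 := by
      have : 2 * z = 0 := by linear_combination e1 - e2
      exact (mul_eq_zero.mp this).resolve_left h2
    subst hz0
    have hb : b = 2 * (r ^ 2 - d) * r - a * r := by linear_combination e1
    have ha : a = 3 * r ^ 2 + d := by
      rw [fiberDisc, hb] at hz
      have : 2 ^ 2 * (r ^ 2 - d) * (r ^ 2 - d) * (3 * r ^ 2 + d - a) = 0 := by
        linear_combination hz
      have h0 : 2 ^ 2 * (r ^ 2 - d) * (r ^ 2 - d) ≠ 0 := by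
        have := hsub r
        positivity
      linear_combination -(mul_eq_zero.mp this).resolve_left h0
    exact ⟨r, ha, by rw [hb, ha]; ring⟩
  · right
    push Not at hsq
    obtain ⟨hb, ha⟩ := eq_of_not_isSquare_fiberDisc hodd hd hab hsq
    refine ⟨hb, ha, ?_⟩
    rintro ⟨z, hz⟩
    refine hsq z ⟨0, ?_⟩
    rw [fiberDisc, hb, ha]
    linear_combination -4 * d * (z * z + 3 * d) * hz

/-- `w` is the image of `z` under a Möbius transformation over `F`. -/
def MobiusRel {F : Type} [Field F] (z w : RatFunc F) : Prop :=
  ∃ a b c d : F, a * d - b * c ≠ 0 ∧ RatFunc.C c * z + RatFunc.C d ≠ 0 ∧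
    w * (RatFunc.C c * z + RatFunc.C d) = RatFunc.C a * z + RatFunc.C b

lemma MobiusRel.symm {F : Type} [Field F] {z w : RatFunc F} (h : MobiusRel z w) :
    MobiusRel w z := by
  obtain ⟨a, b, c, d, hdet, h0, h⟩ := h
  refine ⟨d, -b, -c, a, by convert hdet using 1; ring, ?_, ?_⟩
  · intro h1
    have : RatFunc.C (a * d - b * c) = 0 := by
      simp only [map_sub, map_mul, map_neg] at h1 ⊢
      linear_combination (RatFunc.C c * z + RatFunc.C d) * h1 + RatFunc.C c * h
    exact hdet ((map_eq_zero RatFunc.C).mp this)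
  · simp only [map_neg]
    linear_combination -h

lemma MobiusRel.trans {F : Type} [Field F] {z w u : RatFunc F} (h : MobiusRel z w)
    (h' : MobiusRel w u) : MobiusRel z u := by
  obtain ⟨a, b, c, d, hdet, h0, h⟩ := h
  obtain ⟨a', b', c', d', hdet', h0', h'⟩ := h'
  have key : RatFunc.C (c' * a + d' * c) * z + RatFunc.C (c' * b + d' * d) =
      (RatFunc.C c' * w + RatFunc.C d') * (RatFunc.C c * z + RatFunc.C d) := by
    simp only [map_add, map_mul]
    linear_combination -RatFunc.C c' * h
  refine ⟨a' * a + b' * c, a' * b + b' * d, c' * a + d' * c, c' * b + d' * d, ?_, ?_, ?_⟩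
  · convert mul_ne_zero hdet hdet' using 1; ring
  · rw [key]; exact mul_ne_zero h0' h0
  · rw [key]
    simp only [map_add, map_mul]
    linear_combination (RatFunc.C c * z + RatFunc.C d) * h' + RatFunc.C a' * h

lemma MobiusRel.map {F : Type} [Field F] {z w : RatFunc F} (h : MobiusRel z w)
    (σ : RatFunc F →ₐ[F] RatFunc F) : MobiusRel (σ z) (σ w) := by
  have hC (c : F) : σ (RatFunc.C c) = RatFunc.C c := by
    rw [← RatFunc.algebraMap_eq_C]; exact σ.commutes c
  obtain ⟨a, b, c, d, hdet, h0, h⟩ := h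
  refine ⟨a, b, c, d, hdet, ?_, ?_⟩
  · have := (map_ne_zero σ).mpr h0
    simpa [hC] using this
  · simpa [hC] using congrArg σ h

lemma MobiusRel.ne_C {F : Type} [Field F] {m : RatFunc F} (h : MobiusRel RatFunc.X m) :
    ¬∃ c, m = RatFunc.C c := by
  rintro ⟨e, rfl⟩
  obtain ⟨a, b, c, d, -, h0, h⟩ := h.symm
  refine RatFunc.transcendental_X (K := F) ?_
  rw [(eq_div_iff h0).mpr h, ← map_mul, ← map_mul, ← map_add, ← map_add, ← map_div₀,
    ← RatFunc.algebraMap_eq_C]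
  exact isAlgebraic_algebraMap _

lemma RatFunc.algHom_apply_eq_aeval_div {F : Type} [Field F] (σ : RatFunc F →ₐ[F] RatFunc F)
    (p q : F[X]) : σ (algebraMap F[X] (RatFunc F) p / algebraMap F[X] (RatFunc F) q) =
      aeval (σ RatFunc.X) p / aeval (σ RatFunc.X) q := by
  have h (p : F[X]) : σ (algebraMap F[X] (RatFunc F) p) = aeval (σ RatFunc.X) p := by
    rw [aeval_algHom_apply, ← RatFunc.algebraMap_X, aeval_algebraMap_apply, aeval_X_left_apply]
  rw [map_div₀, h, h]

lemma rfComp_algHom_X {F : Type} [Field F] (σ : RatFunc F →ₐ[F] RatFunc F) (φ : RatFunc F) :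
    rfComp φ (σ RatFunc.X) = σ φ := by
  rw [rfComp, ← RatFunc.algHom_apply_eq_aeval_div, RatFunc.num_div_denom]

lemma RatFunc.algHom_ext_X {F : Type} [Field F] {σ τ : RatFunc F →ₐ[F] RatFunc F}
    (h : σ RatFunc.X = τ RatFunc.X) (φ : RatFunc F) : σ φ = τ φ := by
  rw [← rfComp_algHom_X, h, rfComp_algHom_X]

/-- Substitution of a Möbius transformation is an algebra endomorphism of `F(x)`. -/
lemma MobiusRel.exists_algHom {F : Type} [Field F] {m : RatFunc F}
    (h : MobiusRel RatFunc.X m) : ∃ σ : RatFunc F →ₐ[F] RatFunc F, σ RatFunc.X = m := by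
  have htr : Transcendental F m := RatFunc.transcendental_of_ne_C m h.ne_C
  have hinj := transcendental_iff_injective.mp htr
  refine ⟨RatFunc.liftAlgHom (aeval m) (nonZeroDivisors_le_comap_nonZeroDivisors_of_injective _
    hinj), ?_⟩
  simp [RatFunc.liftAlgHom_apply]

/-- Equivalence of rational functions, phrased through an algebra endomorphism of `F(x)`. -/
def MobiusEquiv {F : Type} [Field F] (φ ψ : RatFunc F) : Prop :=
  ∃ σ : RatFunc F →ₐ[F] RatFunc F, MobiusRel RatFunc.X (σ RatFunc.X) ∧ MobiusRel (σ φ) ψ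

lemma MobiusRel.mobiusEquiv {F : Type} [Field F] {φ ψ : RatFunc F} (h : MobiusRel φ ψ) :
    MobiusEquiv φ ψ :=
  ⟨AlgHom.id F _, ⟨1, 0, 0, 1, by simp, by simp, by simp⟩, h⟩

lemma MobiusEquiv.symm {F : Type} [Field F] {φ ψ : RatFunc F} (h : MobiusEquiv φ ψ) :
    MobiusEquiv ψ φ := by
  obtain ⟨σ, hσ, h⟩ := h
  have hC (c : F) : σ (RatFunc.C c) = RatFunc.C c := by
    rw [← RatFunc.algebraMap_eq_C]; exact σ.commutes c
  obtain ⟨m, hm, hσm⟩ : ∃ m, MobiusRel RatFunc.X m ∧ σ m = RatFunc.X := by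
    obtain ⟨a, b, c, d, hdet, h0, h1⟩ := hσ.symm
    have h2 : σ (RatFunc.C c * RatFunc.X + RatFunc.C d) ≠ 0 := by simpa [hC] using h0
    have h3 : RatFunc.C c * RatFunc.X + RatFunc.C d ≠ 0 := fun h => h2 (by rw [h, map_zero])
    refine ⟨(RatFunc.C a * RatFunc.X + RatFunc.C b) / (RatFunc.C c * RatFunc.X + RatFunc.C d),
      ⟨a, b, c, d, hdet, h3, div_mul_cancel₀ _ h3⟩, ?_⟩
    rw [map_div₀, div_eq_iff h2]
    simp [hC, h1]
  obtain ⟨τ, hτ⟩ := hm.exists_algHom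
  have hστ (z : RatFunc F) : σ (τ z) = z :=
    RatFunc.algHom_ext_X (σ := σ.comp τ) (τ := AlgHom.id F _) (by simp [hτ, hσm]) z
  have hτσ (z : RatFunc F) : τ (σ z) = z := σ.toRingHom.injective (hστ (σ z))
  refine ⟨τ, hτ ▸ hm, ?_⟩
  simpa [hτσ] using (h.map τ).symm

lemma MobiusEquiv.trans {F : Type} [Field F] {φ ψ χ : RatFunc F} (h : MobiusEquiv φ ψ)
    (h' : MobiusEquiv ψ χ) : MobiusEquiv φ χ := by
  obtain ⟨σ, hσ, h⟩ := h
  obtain ⟨τ, hτ, h'⟩ := h'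
  exact ⟨τ.comp σ, hτ.trans (hσ.map τ), (h.map τ).trans h'⟩

lemma MobiusEquiv.rfEquiv {F : Type} [Field F] {φ ψ : RatFunc F} (h : MobiusEquiv φ ψ) :
    RFEquiv φ ψ := by
  obtain ⟨σ, ⟨a', b', c', d', hdet', h0', hσ⟩, ⟨a, b, c, d, hdet, h0, h⟩⟩ := h
  refine ⟨(RatFunc.C a * RatFunc.X + RatFunc.C b) / (RatFunc.C c * RatFunc.X + RatFunc.C d),
    σ RatFunc.X, ⟨a, b, c, d, hdet, rfl⟩,
    ⟨a', b', c', d', hdet', by rw [eq_div_iff h0']; exact hσ⟩, ?_⟩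
  rw [rfComp_algHom_X]
  set p : F[X] := C a * X + C b
  set q : F[X] := C c * X + C d
  set z := σ φ
  have hpz : aeval z p = RatFunc.C a * z + RatFunc.C b := by
    simp [p, RatFunc.algebraMap_eq_C]
  have hqz : aeval z q = RatFunc.C c * z + RatFunc.C d := by
    simp [q, RatFunc.algebraMap_eq_C]
  have hqz0 : aeval z q ≠ 0 := by rwa [hqz]
  have hq0 : q ≠ 0 := fun h => hqz0 (by rw [h, map_zero])
  have hm : (RatFunc.C a * RatFunc.X + RatFunc.C b) / (RatFunc.C c * RatFunc.X + RatFunc.C d) =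
      algebraMap F[X] (RatFunc F) p / algebraMap F[X] (RatFunc F) q := by
    simp [p, q]
  rw [hm]
  set m := algebraMap F[X] (RatFunc F) p / algebraMap F[X] (RatFunc F) q with hmdef
  have hden : aeval z m.denom ≠ 0 := by
    obtain ⟨r, hr⟩ := (RatFunc.denom_dvd hq0).mpr ⟨p, hmdef⟩
    intro h1
    exact hqz0 (by rw [hr, map_mul, h1, zero_mul])
  have hcross : m.num * q = p * m.denom := by
    apply RatFunc.algebraMap_injective F
    have h1 := RatFunc.num_div_denom m
    have h2 : algebraMap F[X] (RatFunc F) m.denom ≠ 0 := by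
      simpa using m.denom_ne_zero
    have h3 : algebraMap F[X] (RatFunc F) q ≠ 0 := by simpa using hq0
    rw [map_mul, map_mul, ← div_eq_div_iff h2 h3, h1]
  have hcrossInv := congrArg (aeval z) hcross
  rw [map_mul, map_mul, hpz, hqz, ← h] at hcrossInv
  rw [rfComp, div_eq_iff hden]
  apply mul_right_cancel₀ h0
  linear_combination hcrossInv

/-- The normal forms of separable permutation rational functions of degree three. -/
def IsCubicNormalForm {F : Type} [Field F] (φ : RatFunc F) : Prop :=
  (φ = RatFunc.X ^ 3 ∧ ¬IsSquare (-3 : F)) ∨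
  (∃ e : F, φ = RatFunc.X ^ 3 - RatFunc.C e * RatFunc.X ∧ (3 : F) = 0 ∧ ¬IsSquare e) ∨
  (∃ d : F, φ = (RatFunc.X ^ 3 - RatFunc.C (9 * d) * RatFunc.X) / (RatFunc.X ^ 2 - RatFunc.C d) ∧
    ¬IsSquare d ∧ ¬IsSquare (-3 * d))

lemma ratFunc_X_sq_sub_C_ne_zero {F : Type} [Field F] (d : F) :
    (RatFunc.X ^ 2 - RatFunc.C d : RatFunc F) ≠ 0 := by
  have h : (X ^ 2 - C d : F[X]) ≠ 0 := X_pow_sub_C_ne_zero two_pos d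
  have := (map_ne_zero_iff _ (RatFunc.algebraMap_injective F)).mpr h
  simpa using this

lemma mobiusRel_C_mul_X_add_C {F : Type} [Field F] {c : F} (hc : c ≠ 0) (s : F) :
    MobiusRel RatFunc.X (RatFunc.C c * RatFunc.X + RatFunc.C s) :=
  ⟨c, s, 0, 1, by simpa using hc, by simp, by simp⟩

/-- Substitution of an affine transformation is an algebra endomorphism of `F(x)`. -/
lemma exists_algHom_X_eq_affine {F : Type} [Field F] {c : F} (hc : c ≠ 0) (s : F) :
    ∃ σ : RatFunc F →ₐ[F] RatFunc F, MobiusRel RatFunc.X (σ RatFunc.X) ∧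
      σ RatFunc.X = RatFunc.C c * RatFunc.X + RatFunc.C s ∧
      ∀ e, σ (RatFunc.C e) = RatFunc.C e := by
  obtain ⟨σ, hσ⟩ := (mobiusRel_C_mul_X_add_C hc s).exists_algHom
  refine ⟨σ, hσ ▸ mobiusRel_C_mul_X_add_C hc s, hσ, fun e => ?_⟩
  rw [← RatFunc.algebraMap_eq_C]
  exact σ.commutes e

lemma MobiusEquiv.of_isCubicNormalForm {F : Type} [Field F] [Fintype F] {φ ψ : RatFunc F}
    (hφ : IsCubicNormalForm φ) (hψ : IsCubicNormalForm ψ) : MobiusEquiv φ ψ := by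
  have hrefl (φ : RatFunc F) : MobiusEquiv φ φ :=
    MobiusRel.mobiusEquiv ⟨1, 0, 0, 1, by simp, by simp, by simp⟩
  have hneg {d : F} (h1 : ¬IsSquare d) (h2 : ¬IsSquare (-3 * d)) : IsSquare (-3 : F) := by
    have hd0 : d ≠ 0 := fun h => h1 (h ▸ IsSquare.zero)
    obtain ⟨z, hz⟩ := isSquare_mul_of_not_isSquare h2 h1
    refine ⟨z / d, ?_⟩
    field_simp
    linear_combination hz
  have hratio {d e : F} (h1 : ¬IsSquare d) (h2 : ¬IsSquare e) : ∃ c ≠ 0, d = c ^ 2 * e := by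
    have hd0 : d ≠ 0 := fun h => h1 (h ▸ IsSquare.zero)
    have he0 : e ≠ 0 := fun h => h2 (h ▸ IsSquare.zero)
    obtain ⟨z, hz⟩ := isSquare_mul_of_not_isSquare h1 h2
    refine ⟨z / e, div_ne_zero ?_ he0, ?_⟩
    · rintro rfl
      simp [hd0, he0] at hz
    · field_simp
      linear_combination hz
  rcases hφ with ⟨rfl, h3⟩ | ⟨d, rfl, h3, hd⟩ | ⟨d, rfl, hd, h3d⟩ <;>
    rcases hψ with ⟨rfl, h3'⟩ | ⟨e, rfl, h3', he⟩ | ⟨e, rfl, he, h3e⟩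
  · exact hrefl _
  · exact absurd (by simp [h3']) h3
  · exact absurd (hneg he h3e) h3
  · exact absurd (by simp [h3]) h3'
  · obtain ⟨c, hc, rfl⟩ := hratio hd he
    obtain ⟨σ, hσ, hX, hC⟩ := exists_algHom_X_eq_affine hc 0
    refine ⟨σ, hσ, 1, 0, 0, c ^ 3, by simpa using hc, by simpa using hc, ?_⟩
    simp only [map_sub, map_mul, map_pow, hX, hC, map_zero, map_one]
    ring
  · exact absurd (by simp [h3]) h3e
  · exact absurd (hneg hd h3d) h3'
  · exact absurd (by simp [h3']) h3d
  · obtain ⟨c, hc, rfl⟩ := hratio hd he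
    obtain ⟨σ, hσ, hX, hC⟩ := exists_algHom_X_eq_affine hc 0
    refine ⟨σ, hσ, 1, 0, 0, c, by simpa using hc, by simpa using hc, ?_⟩
    have h1 := ratFunc_X_sq_sub_C_ne_zero e
    have hc' : (RatFunc.C c : RatFunc F) ≠ 0 := by simpa using hc
    have h2 : (RatFunc.C c * RatFunc.X) ^ 2 - RatFunc.C c ^ 2 * RatFunc.C e ≠ 0 := by
      have : (RatFunc.C c * RatFunc.X) ^ 2 - RatFunc.C c ^ 2 * RatFunc.C e =
        RatFunc.C c ^ 2 * (RatFunc.X ^ 2 - RatFunc.C e) := by ring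
      rw [this]; positivity
    simp only [map_div₀, map_sub, map_mul, map_pow, hX, hC, map_zero, map_one, add_zero,
      map_ofNat, zero_mul, zero_add, one_mul]
    rw [div_mul_eq_mul_div, div_eq_div_iff h1 h2]
    ring

/-- An injective separable cubic polynomial is equivalent to a normal form. -/
lemma exists_mobiusEquiv_of_injective_cubic {F : Type} [Field F] [Fintype F]
    (hodd : Odd (Fintype.card F)) {c₃ c₂ c₁ c₀ : F} (hc₃ : c₃ ≠ 0)
    (hsep : (3 : F) = 0 → c₂ = 0 → c₁ ≠ 0)
    (hinj : Function.Injective fun x => c₃ * x ^ 3 + c₂ * x ^ 2 + c₁ * x + c₀) :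
    ∃ ν, IsCubicNormalForm ν ∧ MobiusEquiv (RatFunc.C c₃ * RatFunc.X ^ 3 +
      RatFunc.C c₂ * RatFunc.X ^ 2 + RatFunc.C c₁ * RatFunc.X + RatFunc.C c₀) ν := by
  have h2 : (2 : F) ≠ 0 := two_ne_zero_of_odd_card hodd
  have hne (x y : F) (hxy : c₃ * (x ^ 2 + x * y + y ^ 2) + c₂ * (x + y) + c₁ = 0) : x = y :=
    hinj (by simp only; linear_combination (x - y) * hxy)
  by_cases h3 : (3 : F) = 0
  · have hc₂ : c₂ = 0 := by
      by_contra hc₂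
      have hv := hne (((-(c₃ + c₁) / c₂) + 1) / 2) (((-(c₃ + c₁) / c₂) - 1) / 2) (by
        field_simp
        linear_combination ((c₁ + c₃) ^ 2 * c₃ - c₃ * c₂ ^ 2) * h3)
      field_simp at hv
      exact mul_ne_zero h2 hc₂ (by linear_combination hv)
    have hc₁ := hsep h3 hc₂
    subst hc₂
    refine ⟨_, Or.inr (Or.inl ⟨-c₁ / c₃, rfl, h3, ?_⟩), MobiusRel.mobiusEquiv
      ⟨1, -c₀, 0, c₃, by simpa using hc₃, by simpa using hc₃, ?_⟩⟩
    · rintro ⟨z, hz⟩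
      field_simp at hz
      have := hne z 0 (by linear_combination -hz)
      subst this
      exact hc₁ (by linear_combination -hz)
    · have hc₃' : (RatFunc.C c₃ : RatFunc F) ≠ 0 := by simpa using hc₃
      simp only [map_div₀, map_neg, map_zero, map_one]
      field_simp
      ring
  · set s := c₂ / (3 * c₃) with hs
    have hc₂ : c₂ = 3 * c₃ * s := by rw [hs]; field_simp
    set t := c₁ - 3 * c₃ * s ^ 2 with ht
    have hc₁ : c₁ = 3 * c₃ * s ^ 2 + t := by rw [ht]; ring
    have hne' (x y : F) (hxy : c₃ * (x ^ 2 + x * y + y ^ 2) + t = 0) : x = y := by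
      have := hne (x - s) (y - s) (by rw [hc₂, hc₁]; linear_combination hxy)
      linear_combination this
    have hsolve : ∃ x y : F, c₃ * (x ^ 2 + x * y + y ^ 2) + t = 0 := by
      obtain ⟨u, v, huv⟩ := FiniteField.exists_root_sum_quadratic (R := F)
        (f := C c₃ * X ^ 2 + C 0 * X + C 0) (g := C (3 * c₃) * X ^ 2 + C 0 * X + C (4 * t))
        (degree_quadratic hc₃) (degree_quadratic (mul_ne_zero h3 hc₃)) (Nat.odd_iff.mp hodd)
      simp only [eval_add, eval_mul, eval_C, eval_pow, eval_X] at huv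
      refine ⟨(u - v) / 2, v, ?_⟩
      field_simp
      linear_combination huv
    obtain ⟨x, y, hxy⟩ := hsolve
    have hxy1 := hne' x y hxy
    subst hxy1
    have hx : 3 * x = 0 := by
      have := hne' x (-2 * x) (by linear_combination hxy)
      linear_combination this
    have hx0 : x = 0 := (mul_eq_zero.mp hx).resolve_left h3
    subst hx0
    have ht0 : t = 0 := by linear_combination hxy
    rw [ht0] at hne' hc₁
    obtain ⟨σ, hσ, hX, hC⟩ := exists_algHom_X_eq_affine (one_ne_zero (α := F)) (-s)
    refine ⟨_, Or.inl ⟨rfl, ?_⟩, σ, hσ, 1, -(c₀ - c₃ * s ^ 3), 0, c₃, by simpa using hc₃,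
      by simpa using hc₃, ?_⟩
    · rintro ⟨z, hz⟩
      have := hne' 2 (z - 1) (by linear_combination -c₃ * hz)
      have hz3 : z = 3 := by linear_combination -this
      subst hz3
      have h12 : (2 : F) ^ 2 * 3 = 0 := by linear_combination -hz
      exact (mul_ne_zero (pow_ne_zero 2 h2) h3) h12
    · simp only [map_add, map_sub, map_mul, map_pow, hX, hC, map_zero, map_one, map_neg, hc₁, hc₂,
        map_ofNat]
      ring

/-- The normal form of `x + (ax + b)/(x² - d)` when it is injective on `𝔽_q`. -/
lemma exists_mobiusEquiv_of_quadratic_denom {F : Type} [Field F] [Fintype F]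
    (hodd : Odd (Fintype.card F)) {d a b : F} (hd : ¬IsSquare d) (hab : a ≠ 0 ∨ b ≠ 0)
    (h : ∀ x y, x ≠ y →
      (x ^ 2 - d) * (y ^ 2 - d) - a * x * y - a * d - b * (x + y) ≠ 0) :
    ∃ ν, IsCubicNormalForm ν ∧ MobiusEquiv ((RatFunc.X ^ 3 - RatFunc.C d * RatFunc.X +
      RatFunc.C a * RatFunc.X + RatFunc.C b) / (RatFunc.X ^ 2 - RatFunc.C d)) ν := by
  have hsub (x : F) : x ^ 2 - d ≠ 0 := fun h0 => hd ⟨x, by linear_combination -h0⟩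
  have hden := ratFunc_X_sq_sub_C_ne_zero d
  obtain ⟨r, ha, hb⟩ | ⟨hb, ha, h3d⟩ := exists_triple_point_or hodd hd hab h
  · have hXr : (RatFunc.X - RatFunc.C r : RatFunc F) ≠ 0 := by
      have := (map_ne_zero_iff _ (RatFunc.algebraMap_injective F)).mpr (X_sub_C_ne_zero r)
      simpa using this
    set w : RatFunc F := (RatFunc.X ^ 2 - RatFunc.C d) / (RatFunc.X - RatFunc.C r) ^ 3 with hw
    have hrel : MobiusRel ((RatFunc.X ^ 3 - RatFunc.C d * RatFunc.X +
        RatFunc.C a * RatFunc.X + RatFunc.C b) / (RatFunc.X ^ 2 - RatFunc.C d)) w := by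
      have hz : RatFunc.C 1 * ((RatFunc.X ^ 3 - RatFunc.C d * RatFunc.X +
          RatFunc.C a * RatFunc.X + RatFunc.C b) / (RatFunc.X ^ 2 - RatFunc.C d)) +
          RatFunc.C (-3 * r) =
          (RatFunc.X - RatFunc.C r) ^ 3 / (RatFunc.X ^ 2 - RatFunc.C d) := by
        rw [ha, hb]
        simp only [map_add, map_sub, map_mul, map_pow, map_neg, map_ofNat, map_one]
        field_simp
        ring
      refine ⟨0, 1, 1, -3 * r, by simp, ?_, ?_⟩
      · rw [hz]; exact div_ne_zero (pow_ne_zero 3 hXr) hden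
      · rw [hz, hw]
        simp only [map_zero, map_one]
        field_simp
        ring
    have hXrel : MobiusRel (RatFunc.X : RatFunc F) (RatFunc.C r + 1 / RatFunc.X) := by
      have hX := RatFunc.X_ne_zero (K := F)
      refine ⟨r, 1, 1, 0, by simp, by simpa using hX, ?_⟩
      simp only [map_zero, map_one]
      field_simp
      ring
    obtain ⟨σ, hσ⟩ := hXrel.exists_algHom
    have hC (c : F) : σ (RatFunc.C c) = RatFunc.C c := by
      rw [← RatFunc.algebraMap_eq_C]; exact σ.commutes c
    have hσw : σ w = RatFunc.C (r ^ 2 - d) * RatFunc.X ^ 3 + RatFunc.C (2 * r) * RatFunc.X ^ 2 +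
        RatFunc.C 1 * RatFunc.X + RatFunc.C 0 := by
      have hX := RatFunc.X_ne_zero (K := F)
      rw [hw]
      simp only [map_sub, map_mul, map_pow, map_div₀, hC, hσ, map_ofNat, map_one, map_zero]
      rw [add_sub_cancel_left]
      field_simp
      ring
    have hequiv : MobiusEquiv _ (σ w) := ⟨σ, hσ ▸ hXrel, hrel.map σ⟩
    have hG0 (v : F) (hv : (r ^ 2 - d) * v ^ 3 + 2 * r * v ^ 2 + 1 * v + 0 = 0) : v = 0 := by
      by_contra hv0
      refine hsub (r + 1 / v) ?_
      field_simp
      rw [mul_zero]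
      refine (mul_eq_zero.mp (?_ : v * _ = 0)).resolve_left hv0
      linear_combination hv
    obtain ⟨ν, hν, hequiv'⟩ := exists_mobiusEquiv_of_injective_cubic hodd (c₃ := r ^ 2 - d)
      (c₂ := 2 * r) (c₁ := 1) (c₀ := 0) (hsub r) (fun _ _ => one_ne_zero) (by
        intro u v huv
        simp only at huv
        by_cases hu : u = 0
        · subst hu
          exact (hG0 v (by linear_combination -huv)).symm
        by_cases hv : v = 0
        · subst hv
          exact hG0 u (by linear_combination huv)
        by_contra hne
        have hQ : (r ^ 2 - d) * (u ^ 2 + u * v + v ^ 2) + 2 * r * (u + v) + 1 = 0 := by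
          refine (mul_eq_zero.mp (?_ : (u - v) * _ = 0)).resolve_left (sub_ne_zero.mpr hne)
          linear_combination huv
        refine h (r + 1 / u) (r + 1 / v) ?_ ?_
        · intro h0
          field_simp at h0
          exact hne (by linear_combination -h0)
        · rw [ha, hb]
          field_simp
          linear_combination hQ)
    exact ⟨ν, hν, hequiv.trans (hσw ▸ hequiv')⟩
  · refine ⟨_, Or.inr (Or.inr ⟨d, rfl, hd, h3d⟩), MobiusRel.mobiusEquiv
      ⟨1, 0, 0, 1, by simp, by simp, ?_⟩⟩
    rw [ha, hb]
    simp only [map_mul, map_neg, map_ofNat, map_zero, map_one]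
    ring

/-- A degree three fraction `f/g` fixing `∞` and injective on `𝔽_q`, given by coefficients with
`deg g = 2`, is equivalent to a normal form. -/
lemma exists_mobiusEquiv_of_natDegree_two {F : Type} [Field F] [Fintype F]
    (hodd : Odd (Fintype.card F)) {f g : F[X]} {f₀ f₁ f₂ f₃ g₀ g₁ g₂ : F}
    (hf : f = C f₃ * X ^ 3 + C f₂ * X ^ 2 + C f₁ * X + C f₀)
    (hg : g = C g₂ * X ^ 2 + C g₁ * X + C g₀) (hf₃ : f₃ ≠ 0) (hg₂ : g₂ ≠ 0)
    (hroot : ∀ x, g.eval x ≠ 0)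
    (hinj : ∀ x y, f.eval x * g.eval y = f.eval y * g.eval x → x = y) (hcop : IsCoprime f g) :
    ∃ ν, IsCubicNormalForm ν ∧
      MobiusEquiv (algebraMap F[X] (RatFunc F) f / algebraMap F[X] (RatFunc F) g) ν := by
  have h2 : (2 : F) ≠ 0 := two_ne_zero_of_odd_card hodd
  obtain ⟨s, hs⟩ : ∃ s, g₁ = 2 * g₂ * s := ⟨g₁ / (2 * g₂), by field_simp⟩
  obtain ⟨d, hd⟩ : ∃ d, g₀ = g₂ * (s ^ 2 - d) := ⟨s ^ 2 - g₀ / g₂, by field_simp; ring⟩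
  obtain ⟨e, he⟩ : ∃ e, f₂ = f₃ * (e + 3 * s) := ⟨f₂ / f₃ - 3 * s, by field_simp; ring⟩
  obtain ⟨a, ha⟩ : ∃ a, f₁ = f₃ * (a - d) + 2 * f₂ * s - 3 * f₃ * s ^ 2 :=
    ⟨(f₁ - 2 * f₂ * s + 3 * f₃ * s ^ 2) / f₃ + d, by field_simp; ring⟩
  obtain ⟨b, hb⟩ : ∃ b, f₀ = f₃ * (b - e * d) + f₁ * s - f₂ * s ^ 2 + f₃ * s ^ 3 :=
    ⟨(f₀ - f₁ * s + f₂ * s ^ 2 - f₃ * s ^ 3) / f₃ + e * d, by field_simp; ring⟩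
  have hgx (x : F) : g.eval (x - s) = g₂ * (x ^ 2 - d) := by
    simp only [hg, eval_add, eval_mul, eval_C, eval_pow, eval_X, hs, hd]
    ring
  have hfx (x : F) : f.eval (x - s) = f₃ * ((x + e) * (x ^ 2 - d) + a * x + b) := by
    simp only [hf, eval_add, eval_mul, eval_C, eval_pow, eval_X, hb, ha, he]
    ring
  have hdsq : ¬IsSquare d := by
    rintro ⟨z, rfl⟩
    refine hroot (z - s) ?_
    rw [hgx]; ring
  have hab : a ≠ 0 ∨ b ≠ 0 := by
    by_contra hab
    push Not at hab
    obtain ⟨rfl, rfl⟩ := hab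
    have hdvd : g ∣ f := by
      refine ⟨C (f₃ / g₂) * (X + C s + C e), ?_⟩
      have hr : f₃ = f₃ / g₂ * g₂ := by field_simp
      rw [hf, hg, hb, ha, he, hs, hd]
      simp only [map_add, map_sub, map_mul, map_pow, map_ofNat, map_zero]
      have hr' : C f₃ = C (f₃ / g₂) * C g₂ := by rw [← C_mul, ← hr]
      rw [hr']
      ring
    have hunit : IsUnit g := hcop.isUnit_of_dvd' hdvd dvd_rfl
    have hdeg : g.natDegree = 2 := by rw [hg]; exact natDegree_quadratic hg₂
    rw [natDegree_eq_zero_of_isUnit hunit] at hdeg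
    omega
  obtain ⟨ν, hν, hequiv⟩ := exists_mobiusEquiv_of_quadratic_denom hodd hdsq hab (by
    intro x y hxy h0
    refine hxy ?_
    have := hinj (x - s) (y - s) (by
      rw [hgx, hgx, hfx, hfx]
      linear_combination f₃ * g₂ * (x - y) * h0)
    linear_combination this)
  refine ⟨ν, hν, MobiusEquiv.trans ?_ hequiv⟩
  obtain ⟨σ, hσ, hX, hC⟩ := exists_algHom_X_eq_affine (one_ne_zero (α := F)) (-s)
  refine ⟨σ, hσ, g₂, -e * f₃, 0, f₃, by simp [hf₃, hg₂], by simpa using hf₃, ?_⟩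
  have hfσ : σ (algebraMap F[X] (RatFunc F) f) = RatFunc.C f₃ * ((RatFunc.X + RatFunc.C e) *
      (RatFunc.X ^ 2 - RatFunc.C d) + RatFunc.C a * RatFunc.X + RatFunc.C b) := by
    rw [hf, hb, ha, he]
    simp only [map_add, map_sub, map_mul, map_pow, map_ofNat, map_one, map_neg, hX, hC,
      RatFunc.algebraMap_X, RatFunc.algebraMap_C]
    ring
  have hgσ : σ (algebraMap F[X] (RatFunc F) g) =
      RatFunc.C g₂ * (RatFunc.X ^ 2 - RatFunc.C d) := by
    rw [hg, hs, hd]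
    simp only [map_add, map_sub, map_mul, map_pow, map_ofNat, map_one, map_neg, hX, hC,
      RatFunc.algebraMap_X, RatFunc.algebraMap_C]
    ring
  have hden := ratFunc_X_sq_sub_C_ne_zero d
  have hg₂' : (RatFunc.C g₂ : RatFunc F) ≠ 0 := by simpa using hg₂
  rw [map_div₀, hfσ, hgσ]
  simp only [map_mul, map_neg, map_zero]
  field_simp
  ring

/-- A separable degree three fraction `f/g` fixing `∞` and injective on `𝔽_q` is equivalent to a
normal form. -/
lemma exists_mobiusEquiv_of_natDegree_denom_le_two {F : Type} [Field F] [Fintype F]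
    (hodd : Odd (Fintype.card F)) {f g : F[X]} (hf : f.natDegree = 3) (hg : g.natDegree ≤ 2)
    (hroot : ∀ x, g.eval x ≠ 0)
    (hinj : ∀ x y, f.eval x * g.eval y = f.eval y * g.eval x → x = y) (hcop : IsCoprime f g)
    (hsep : ¬(derivative f = 0 ∧ derivative g = 0)) :
    ∃ ν, IsCubicNormalForm ν ∧
      MobiusEquiv (algebraMap F[X] (RatFunc F) f / algebraMap F[X] (RatFunc F) g) ν := by
  obtain ⟨f₀, f₁, f₂, f₃, hf₃, hfeq⟩ : ∃ f₀ f₁ f₂ f₃, f₃ ≠ 0 ∧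
      f = C f₃ * X ^ 3 + C f₂ * X ^ 2 + C f₁ * X + C f₀ := by
    refine ⟨f.coeff 0, f.coeff 1, f.coeff 2, f.coeff 3, ?_, ?_⟩
    · rw [← hf, coeff_natDegree, leadingCoeff_ne_zero]
      rintro rfl
      simp at hf
    · conv_lhs => rw [f.as_sum_range_C_mul_X_pow' (n := 4) (by omega)]
      simp [Finset.sum_range_succ]; ring
  obtain ⟨g₀, g₁, g₂, hgeq⟩ : ∃ g₀ g₁ g₂, g = C g₂ * X ^ 2 + C g₁ * X + C g₀ := by
    refine ⟨g.coeff 0, g.coeff 1, g.coeff 2, ?_⟩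
    conv_lhs => rw [g.as_sum_range_C_mul_X_pow' (n := 3) (by omega)]
    simp [Finset.sum_range_succ]; ring
  by_cases hg₂ : g₂ = 0
  swap
  · exact exists_mobiusEquiv_of_natDegree_two hodd hfeq hgeq hf₃ hg₂ hroot hinj hcop
  have hg₁ : g₁ = 0 := by
    by_contra hg₁
    refine hroot (-g₀ / g₁) ?_
    simp only [hgeq, hg₂, eval_add, eval_mul, eval_C, eval_pow, eval_X]
    field_simp
    ring
  have hgC : g = C g₀ := by simp [hgeq, hg₁, hg₂]
  have hg₀ : g₀ ≠ 0 := by simpa [hgC] using hroot 0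
  obtain ⟨ν, hν, hequiv⟩ := exists_mobiusEquiv_of_injective_cubic hodd (c₃ := f₃) (c₂ := f₂)
    (c₁ := f₁) (c₀ := f₀) hf₃ (by
      rintro h3 rfl rfl
      refine hsep ⟨?_, by simp [hgC]⟩
      have h3' : (C 2 + 1 : F[X]) = 0 := by
        rw [← C_1, ← C_add, show (2 : F) + 1 = 0 by linear_combination h3, C_0]
      simp [hfeq, h3']) (by
      intro x y hxy
      refine hinj x y ?_
      simp only [hgC, hfeq, eval_add, eval_mul, eval_C, eval_pow, eval_X] at hxy ⊢
      rw [hxy])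
  refine ⟨ν, hν, MobiusEquiv.trans (MobiusRel.mobiusEquiv
    ⟨g₀, 0, 0, 1, by simpa using hg₀, by simp, ?_⟩) hequiv⟩
  have hg₀' : (RatFunc.C g₀ : RatFunc F) ≠ 0 := by simpa using hg₀
  rw [hgC, hfeq]
  simp only [map_add, map_mul, map_pow, map_zero, map_one, RatFunc.algebraMap_X,
    RatFunc.algebraMap_C]
  field_simp
  ring

/-- Every separable permutation rational function of degree three over a finite field of odd
order is equivalent to a normal form. -/
lemma exists_mobiusEquiv_isCubicNormalForm {F : Type} [Field F] [Fintype F]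
    (hodd : Odd (Fintype.card F)) (φ : RatFunc F)
    (hdeg : max φ.num.natDegree φ.denom.natDegree = 3)
    (hsep : (fiberPoly φ.num φ.denom).Separable)
    (hbij : Function.Bijective (ratEval φ.num φ.denom)) :
    ∃ ν, IsCubicNormalForm ν ∧ MobiusEquiv φ ν := by
  have hcop := RatFunc.isCoprime_num_denom φ
  have hφ := RatFunc.num_div_denom φ
  have hg0 := φ.denom_ne_zero
  set f := φ.num
  set g := φ.denom
  have hinj := hbij.injective
  have hder : ¬(derivative f = 0 ∧ derivative g = 0) := by
    rintro ⟨h1, h2⟩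
    have hzero : derivative (fiberPoly f g) = 0 := by
      simp [fiberPoly, derivative_map, h1, h2]
    rw [Polynomial.Separable, hzero, isCoprime_zero_right] at hsep
    have hdeg0 := natDegree_eq_zero_of_isUnit hsep
    have hcoeff : (fiberPoly f g).coeff 3 = 0 := coeff_eq_zero_of_natDegree_lt (by omega)
    have hpull : C (f.coeff 3) - X * C (g.coeff 3) = 0 := by
      refine RatFunc.algebraMap_injective F ?_
      simpa only [fiberPoly, coeff_sub, coeff_C_mul, coeff_map, RatFunc.algebraMap_eq_C, map_sub,
        map_mul, RatFunc.algebraMap_C, RatFunc.algebraMap_X, map_zero] using hcoeff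
    have hf3 : f.coeff 3 = 0 := by simpa using congrArg (coeff · 0) hpull
    have hg3 : g.coeff 3 = 0 := by simpa [coeff_C] using congrArg (coeff · 1) hpull
    rcases max_choice f.natDegree g.natDegree with h | h
    · rw [← hdeg, h, coeff_natDegree, leadingCoeff_eq_zero] at hf3
      rw [hf3, natDegree_zero] at h hdeg
      omega
    · rw [← hdeg, h, coeff_natDegree, leadingCoeff_eq_zero] at hg3
      exact hg0 hg3
  have hsome (x : F) (hx : g.eval x ≠ 0) :
      ratEval f g (some x) = some (f.eval x / g.eval x) := by simp [ratEval, hx]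
  have hnone (x : F) (hx : g.eval x = 0) : ratEval f g (some x) = none := by simp [ratEval, hx]
  rcases lt_or_ge g.natDegree f.natDegree with hlt | hle
  · have hinf : ratEval f g none = none := by simp [ratEval, hlt]
    have hroot (x : F) : g.eval x ≠ 0 := fun hx => by
      simpa using hinj ((hnone x hx).trans hinf.symm)
    have := exists_mobiusEquiv_of_natDegree_denom_le_two hodd (f := f) (g := g) (by omega)
      (by omega) hroot (fun x y hxy => by
        refine Option.some_injective _ (hinj ?_)
        rw [hsome x (hroot x), hsome y (hroot y), (div_eq_div_iff (hroot x) (hroot y)).mpr hxy])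
      hcop hder
    rwa [hφ] at this
  · have hg3 : g.natDegree = 3 := by omega
    set c := f.coeff 3 / g.leadingCoeff with hc
    have hinf : ratEval f g none = some c := by
      rcases hle.lt_or_eq with h | h
      · have : f.coeff 3 = 0 := coeff_eq_zero_of_natDegree_lt (by omega)
        simp [ratEval, h, not_lt.mpr h.le, hc, this]
      · have : f.coeff 3 = f.leadingCoeff := by rw [leadingCoeff, h, hg3]
        simp [ratEval, h, hc, this]
    have hf0 (x : F) (hx : g.eval x = 0) : f.eval x ≠ 0 := by
      intro hfx
      obtain ⟨u, v, huv⟩ := hcop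
      have := congrArg (eval x) huv
      simp [hx, hfx] at this
    have hg' : (f - C c * g).natDegree ≤ 2 := by
      refine natDegree_le_iff_coeff_eq_zero.mpr fun N hN => ?_
      rw [coeff_sub, coeff_C_mul]
      rcases (Nat.succ_le_of_lt hN).eq_or_lt with rfl | hN3
      · have hlead : g.coeff 3 = g.leadingCoeff := by rw [leadingCoeff, hg3]
        rw [hlead, hc, div_mul_cancel₀ _ (leadingCoeff_ne_zero.mpr hg0)]
        exact sub_self _
      · rw [coeff_eq_zero_of_natDegree_lt (by omega), coeff_eq_zero_of_natDegree_lt (by omega)]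
        ring
    have hroot (x : F) : (f - C c * g).eval x ≠ 0 := by
      intro hx
      simp only [eval_sub, eval_mul, eval_C] at hx
      by_cases hgx : g.eval x = 0
      · exact hf0 x hgx (by simpa [hgx] using hx)
      · have h1 : ratEval f g (some x) = some c := by
          rw [hsome x hgx]
          congr 1
          rw [div_eq_iff hgx]
          linear_combination hx
        simpa using hinj (h1.trans hinf.symm)
    obtain ⟨ν, hν, hequiv⟩ := exists_mobiusEquiv_of_natDegree_denom_le_two hodd hg3 hg' hroot
      (fun x y hxy => by
        simp only [eval_sub, eval_mul, eval_C] at hxy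
        have hxy' : f.eval x * g.eval y = f.eval y * g.eval x := by linear_combination -hxy
        refine Option.some_injective _ (hinj ?_)
        by_cases hx : g.eval x = 0
        · have hy : g.eval y = 0 := by
            rw [hx, mul_zero] at hxy'
            exact (mul_eq_zero.mp hxy').resolve_left (hf0 x hx)
          rw [hnone x hx, hnone y hy]
        · have hy : g.eval y ≠ 0 := by
            intro hy
            rw [hy, mul_zero] at hxy'
            exact mul_ne_zero (hf0 y hy) hx hxy'.symm
          rw [hsome x hx, hsome y hy, (div_eq_div_iff hx hy).mpr hxy'])
      (by
        rw [sub_eq_add_neg, ← neg_mul, mul_comm]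
        exact hcop.symm.add_mul_left_right _)
      (by
        rintro ⟨h1, h2⟩
        refine hder ⟨?_, h1⟩
        simpa [h1] using h2)
    refine ⟨ν, hν, MobiusEquiv.trans (MobiusRel.mobiusEquiv ?_) hequiv⟩
    have hga : algebraMap F[X] (RatFunc F) g ≠ 0 := by simpa using hg0
    have hfa : algebraMap F[X] (RatFunc F) (f - C c * g) ≠ 0 := by
      refine (map_ne_zero_iff _ (RatFunc.algebraMap_injective F)).mpr fun h0 => hroot 0 ?_
      rw [h0, eval_zero]
    have hz : RatFunc.C 1 * φ + RatFunc.C (-c) =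
        algebraMap F[X] (RatFunc F) (f - C c * g) / algebraMap F[X] (RatFunc F) g := by
      rw [← hφ]
      simp only [map_sub, map_mul, map_one, map_neg, RatFunc.algebraMap_C]
      field_simp
      ring
    refine ⟨0, 1, 1, -c, by simp, ?_, ?_⟩
    · rw [hz]; exact div_ne_zero hfa hga
    · rw [hz]
      simp only [map_zero, map_one]
      field_simp
      ring

theorem stmt_9 (F : Type) [Field F] [Fintype F] (hodd : Odd (Fintype.card F))
    (φ ψ : RatFunc F)
    (hφd : max φ.num.natDegree φ.denom.natDegree = 3)
    (hψd : max ψ.num.natDegree ψ.denom.natDegree = 3)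
    (hφs : (fiberPoly φ.num φ.denom).Separable)
    (hψs : (fiberPoly ψ.num ψ.denom).Separable)
    (hφp : Function.Bijective (ratEval φ.num φ.denom))
    (hψp : Function.Bijective (ratEval ψ.num ψ.denom)) :
    RFEquiv φ ψ := by
  obtain ⟨ν, hν, h⟩ := exists_mobiusEquiv_isCubicNormalForm hodd φ hφd hφs hφp
  obtain ⟨ν', hν', h'⟩ := exists_mobiusEquiv_isCubicNormalForm hodd ψ hψd hψs hψp
  exact ((h.trans (MobiusEquiv.of_isCubicNormalForm hν hν')).trans h'.symm).rfEquiv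

end
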